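/- arXiv:2407.11430 — 2 statements merged into one kernel-verified Lean document; each statement's English description precedes it below -/
import Mathlib

section
/- Let N ≥ 2, M ≥ 1 be integers. The map sending a matrix (a b; c d) ∈ SL₂(ℤ) to (a mod N, b mod N; c mod MN, d mod MN) induces a well-defined bijection from the set of right cosets Γ(N, MN)\SL₂(ℤ) onto the finite set S_{2,1}. -/
open Matrix

/-- Reduction of an integer congruence modulo `M*N` to one modulo `N`. -/
lemma castDown {N M : ℕ} {x y : ℤ} (h : (x : ZMod (M*N)) = (y : ZMod (M*N))) :
    (x : ZMod N) = (y : ZMod N) := by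
  rw [ZMod.intCast_eq_intCast_iff] at h ⊢
  exact h.of_dvd (Int.natCast_dvd_natCast.2 (dvd_mul_left N M))

/-- The congruence subgroup `Γ(N, MN)` of `SL₂(ℤ)`: matrices `(a b; c d)` with
`a ≡ 1, b ≡ 0 (mod N)` and `c ≡ 0, d ≡ 1 (mod MN)`. -/
def GammaNM (N M : ℕ) : Subgroup (Matrix.SpecialLinearGroup (Fin 2) ℤ) where
  carrier := {γ | ((γ.1 0 0 : ℤ) : ZMod N) = 1 ∧ ((γ.1 0 1 : ℤ) : ZMod N) = 0 ∧
    ((γ.1 1 0 : ℤ) : ZMod (M*N)) = 0 ∧ ((γ.1 1 1 : ℤ) : ZMod (M*N)) = 1}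
  one_mem' := by
    refine ⟨?_, ?_, ?_, ?_⟩ <;>
      simp [Matrix.SpecialLinearGroup.coe_one, Matrix.one_apply]
  mul_mem' := by
    rintro a b ⟨ha1, ha2, ha3, ha4⟩ ⟨hb1, hb2, hb3, hb4⟩
    have hmul : ∀ i j, ((a*b).1 : Matrix (Fin 2) (Fin 2) ℤ) i j
        = a.1 i 0 * b.1 0 j + a.1 i 1 * b.1 1 j := by
      intro i j
      rw [Matrix.SpecialLinearGroup.coe_mul, Matrix.mul_apply, Fin.sum_univ_two]
    have hb3N : ((b.1 1 0 : ℤ) : ZMod N) = 0 := by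
      simpa using castDown (N := N) (M := M) (y := 0) (by simpa using hb3)
    refine ⟨?_, ?_, ?_, ?_⟩
    · rw [hmul 0 0]; push_cast
      rw [ha1, ha2, hb1, hb3N]; ring
    · rw [hmul 0 1]; push_cast
      rw [ha1, ha2, hb2]; ring
    · rw [hmul 1 0]; push_cast
      rw [ha3, ha4, hb3]; ring
    · rw [hmul 1 1]; push_cast
      rw [ha3, ha4, hb4]; ring
  inv_mem' := by
    rintro a ⟨ha1, ha2, ha3, ha4⟩
    -- first: `a ≡ 1 (mod MN)` automatically
    have hdet : ((a.1 0 0 * a.1 1 1 - a.1 0 1 * a.1 1 0 : ℤ) : ZMod (M*N)) = 1 := by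
      rw [← Matrix.det_fin_two]
      simp [a.2]
    have ha1MN : ((a.1 0 0 : ℤ) : ZMod (M*N)) = 1 := by
      push_cast at hdet
      rw [ha3, ha4] at hdet
      simpa using hdet
    have hd : ((a.1 1 1 : ℤ) : ZMod N) = 1 := by
      have h4' : ((a.1 1 1 : ℤ) : ZMod (M*N)) = ((1 : ℤ) : ZMod (M*N)) := by
        push_cast; exact ha4
      have := castDown (N := N) (M := M) h4'
      push_cast at this; exact this
    have hinv := Matrix.SpecialLinearGroup.SL2_inv_expl a
    refine ⟨?_, ?_, ?_, ?_⟩ <;>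
      rw [hinv] <;>
      simp only [Matrix.cons_val_zero, Matrix.cons_val_one, Matrix.head_cons,
        Matrix.head_fin_const, Int.cast_neg, neg_eq_zero]
    · exact hd
    · exact ha2
    · exact ha3
    · exact ha1MN

/-- The set of `n`-tuples of elements of `A` which generate `A`. -/
def GenTuple (n : ℕ) (A : Type) [AddCommGroup A] : Type :=
  {b : Fin n → A // AddSubgroup.closure (Set.range b) = ⊤}

/-- The determinant (mod `N`) of a pair of characters of `ℤ/N × ℤ/MN`:
for `β = ((a₁,b₁),(a₂,b₂))` it is `a₁b₂ - a₂b₁ ∈ ℤ/N`. -/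
def detp (N M : ℕ) (β : GenTuple 2 (ZMod N × ZMod (M*N))) : ZMod N :=
  (β.1 0).1 * ZMod.castHom (dvd_mul_left N M) (ZMod N) (β.1 1).2
    - (β.1 1).1 * ZMod.castHom (dvd_mul_left N M) (ZMod N) (β.1 0).2

/-- A unimodular pair modulo `n` lifts to a pair of coprime integers. -/
lemma exists_isCoprime_lift {n : ℕ} [NeZero n] {x y r s : ZMod n} (h : r * x + s * y = 1) :
    ∃ c d : ℤ, IsCoprime c d ∧ (c : ZMod n) = x ∧ (d : ZMod n) = y := by
  obtain ⟨c, hc0, hc⟩ : ∃ c : ℕ, c ≠ 0 ∧ (c : ZMod n) = x :=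
    ⟨x.val + n, by have := NeZero.ne n; omega, by simp⟩
  have : NeZero c := ⟨hc0⟩
  obtain ⟨e, he, u, hu, hy⟩ := ZMod.eq_unit_mul_divisor y
  obtain ⟨v, hv⟩ := ZMod.unitsMap_surjective (dvd_mul_right n c) hu.unit
  have hvu : (((v : ZMod (n * c)).val : ℕ) : ZMod n) = u := by
    have := congrArg Units.val hv
    rw [ZMod.unitsMap_val] at this
    rw [ZMod.natCast_val]
    exact this
  refine ⟨c, ((v : ZMod (n * c)).val * e : ℕ), ?_, by simpa using hc, ?_⟩
  · rw [Nat.isCoprime_iff_coprime]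
    refine Nat.Coprime.mul_right ?_ ?_
    · exact ((ZMod.val_coe_unit_coprime v).coprime_dvd_right (dvd_mul_left c n)).symm
    · have hg : Nat.gcd c e ∣ n := (Nat.gcd_dvd_right c e).trans he
      have h1 := congrArg (ZMod.castHom hg (ZMod (Nat.gcd c e))) h
      have hc' : ((c : ℕ) : ZMod (Nat.gcd c e)) = 0 :=
        (ZMod.natCast_eq_zero_iff _ _).2 (Nat.gcd_dvd_left c e)
      have he' : ((e : ℕ) : ZMod (Nat.gcd c e)) = 0 :=
        (ZMod.natCast_eq_zero_iff _ _).2 (Nat.gcd_dvd_right c e)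
      rw [hy, ← hc, map_add, map_mul, map_mul, map_mul, map_natCast, map_natCast, hc', he',
        map_one] at h1
      have h2 : ((1 : ℕ) : ZMod (Nat.gcd c e)) = 0 := by simpa using h1.symm
      exact Nat.dvd_one.1 ((ZMod.natCast_eq_zero_iff _ _).1 h2)
  · rw [Int.cast_natCast, Nat.cast_mul, hvu, hy]

/-- The columns of an integral matrix, its first row being reduced modulo `N` and its second row
modulo `M * N`. -/
def reducedColumns (N M : ℕ) (γ : Matrix.SpecialLinearGroup (Fin 2) ℤ) :
    Fin 2 → ZMod N × ZMod (M*N) :=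
  ![(((γ.1 0 0 : ℤ) : ZMod N), ((γ.1 1 0 : ℤ) : ZMod (M*N))),
    (((γ.1 0 1 : ℤ) : ZMod N), ((γ.1 1 1 : ℤ) : ZMod (M*N)))]

lemma closure_range_reducedColumns (N M : ℕ) (γ : Matrix.SpecialLinearGroup (Fin 2) ℤ) :
    AddSubgroup.closure (Set.range (reducedColumns N M γ)) = ⊤ := by
  rw [eq_top_iff]
  rintro ⟨x, y⟩ -
  obtain ⟨x, rfl⟩ := ZMod.intCast_surjective x
  obtain ⟨y, rfl⟩ := ZMod.intCast_surjective y
  have hdet : γ.1 0 0 * γ.1 1 1 - γ.1 0 1 * γ.1 1 0 = 1 := by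
    rw [← Matrix.det_fin_two, γ.2]
  rw [reducedColumns, Matrix.range_cons_cons_empty, AddSubgroup.mem_closure_pair]
  refine ⟨γ.1 1 1 * x - γ.1 0 1 * y, γ.1 0 0 * y - γ.1 1 0 * x, ?_⟩
  ext
  · have h := congrArg (Int.cast : ℤ → ZMod N) hdet
    push_cast at h
    simp
    linear_combination (x : ZMod N) * h
  · have h := congrArg (Int.cast : ℤ → ZMod (M*N)) hdet
    push_cast at h
    simp
    linear_combination (y : ZMod (M*N)) * h

/-- The pair of columns of a matrix in `SL₂(ℤ)`, as an element of `S_{2,1}`. -/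
def genTupleOfSL (N M : ℕ) (γ : Matrix.SpecialLinearGroup (Fin 2) ℤ) :
    {β : GenTuple 2 (ZMod N × ZMod (M*N)) // detp N M β = 1} :=
  ⟨⟨reducedColumns N M γ, closure_range_reducedColumns N M γ⟩, by
    have hdet : γ.1 0 0 * γ.1 1 1 - γ.1 0 1 * γ.1 1 0 = 1 := by
      rw [← Matrix.det_fin_two, γ.2]
    have := congrArg (Int.cast : ℤ → ZMod N) hdet
    push_cast at this
    simpa [_root_.detp, reducedColumns] using this⟩

lemma reducedColumns_eq_iff {N M : ℕ} {γ δ : Matrix.SpecialLinearGroup (Fin 2) ℤ} :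
    reducedColumns N M γ = reducedColumns N M δ ↔
      (((γ.1 0 0 : ℤ) : ZMod N) = (δ.1 0 0 : ℤ) ∧ ((γ.1 0 1 : ℤ) : ZMod N) = (δ.1 0 1 : ℤ)) ∧
      ((γ.1 1 0 : ℤ) : ZMod (M*N)) = (δ.1 1 0 : ℤ) ∧
        ((γ.1 1 1 : ℤ) : ZMod (M*N)) = (δ.1 1 1 : ℤ) := by
  simp only [reducedColumns, Matrix.vecCons_inj, Prod.mk.injEq, and_true]
  tauto

/-- Two matrices have the same reduced columns exactly when they define the same right coset. -/
lemma reducedColumns_eq_iff_mem {N M : ℕ} {γ δ : Matrix.SpecialLinearGroup (Fin 2) ℤ} :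
    reducedColumns N M γ = reducedColumns N M δ ↔ δ * γ⁻¹ ∈ GammaNM N M := by
  have hmem : δ * γ⁻¹ ∈ GammaNM N M ↔
      ((((δ * γ⁻¹).1 0 0 : ℤ) : ZMod N) = 1 ∧ (((δ * γ⁻¹).1 0 1 : ℤ) : ZMod N) = 0 ∧
        (((δ * γ⁻¹).1 1 0 : ℤ) : ZMod (M*N)) = 0 ∧
          (((δ * γ⁻¹).1 1 1 : ℤ) : ZMod (M*N)) = 1) := Iff.rfl
  have hdet : γ.1 0 0 * γ.1 1 1 - γ.1 0 1 * γ.1 1 0 = 1 := by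
    rw [← Matrix.det_fin_two, γ.2]
  have h0 (i) : (δ * γ⁻¹).1 i 0 = δ.1 i 0 * γ.1 1 1 - δ.1 i 1 * γ.1 1 0 := by
    rw [Matrix.SpecialLinearGroup.coe_mul, Matrix.mul_apply, Fin.sum_univ_two,
      Matrix.SpecialLinearGroup.SL2_inv_expl]
    simp [sub_eq_add_neg]
  have h1 (i) : (δ * γ⁻¹).1 i 1 = δ.1 i 1 * γ.1 0 0 - δ.1 i 0 * γ.1 0 1 := by
    rw [Matrix.SpecialLinearGroup.coe_mul, Matrix.mul_apply, Fin.sum_univ_two,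
      Matrix.SpecialLinearGroup.SL2_inv_expl]
    simp only [Matrix.cons_val_zero, Matrix.cons_val_one, Matrix.cons_val']
    ring
  have hN := congrArg (Int.cast : ℤ → ZMod N) hdet
  have hMN := congrArg (Int.cast : ℤ → ZMod (M*N)) hdet
  rw [hmem, reducedColumns_eq_iff, h0, h0, h1, h1]
  push_cast at hN hMN ⊢
  constructor
  · rintro ⟨⟨ha, hb⟩, hc, hd⟩
    rw [← ha, ← hb, ← hc, ← hd]
    exact ⟨by linear_combination hN, by ring, by ring, by linear_combination hMN⟩
  · rintro ⟨ha, hb, hc, hd⟩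
    refine ⟨⟨?_, ?_⟩, ?_, ?_⟩
    · linear_combination (δ.1 0 0 : ZMod N) * hN - (γ.1 0 0 : ZMod N) * ha
        - (γ.1 1 0 : ZMod N) * hb
    · linear_combination (δ.1 0 1 : ZMod N) * hN - (γ.1 0 1 : ZMod N) * ha
        - (γ.1 1 1 : ZMod N) * hb
    · linear_combination (δ.1 1 0 : ZMod (M*N)) * hMN - (γ.1 0 0 : ZMod (M*N)) * hc
        - (γ.1 1 0 : ZMod (M*N)) * hd
    · linear_combination (δ.1 1 1 : ZMod (M*N)) * hMN - (γ.1 0 1 : ZMod (M*N)) * hc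
        - (γ.1 1 1 : ZMod (M*N)) * hd

/-- The second components of a generating pair form a unimodular pair. -/
lemma GenTuple.exists_mul_snd_add_mul_snd_eq_one {N n : ℕ} (β : GenTuple 2 (ZMod N × ZMod n)) :
    ∃ r s : ZMod n, r * (β.1 0).2 + s * (β.1 1).2 = 1 := by
  have h : ((0, 1) : ZMod N × ZMod n) ∈ AddSubgroup.closure (Set.range β.1) := by
    rw [β.2]
    trivial
  have hrange : Set.range β.1 = {β.1 0, β.1 1} := by
    ext z
    simp [Fin.exists_fin_two, eq_comm]
  rw [hrange, AddSubgroup.mem_closure_pair] at h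
  obtain ⟨r, s, hrs⟩ := h
  refine ⟨r, s, ?_⟩
  simpa using congrArg Prod.snd hrs

lemma genTupleOfSL_surjective (N M : ℕ) [NeZero (M*N)] :
    Function.Surjective (genTupleOfSL N M) := by
  rintro ⟨β, hβ⟩
  obtain ⟨r, s, hrs⟩ := β.exists_mul_snd_add_mul_snd_eq_one
  obtain ⟨c, d, hcd, hc, hd⟩ := exists_isCoprime_lift hrs
  obtain ⟨p, q, hpq⟩ : ∃ p q : ℤ, p * d - q * c = 1 := by
    obtain ⟨u, v, huv⟩ := hcd
    exact ⟨v, -u, by linear_combination huv⟩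
  obtain ⟨a₁, ha₁⟩ := ZMod.intCast_surjective (β.1 0).1
  obtain ⟨a₂, ha₂⟩ := ZMod.intCast_surjective (β.1 1).1
  rw [_root_.detp, ← hc, ← hd, ← ha₁, ← ha₂, map_intCast, map_intCast] at hβ
  have hpqN := congrArg (Int.cast : ℤ → ZMod N) hpq
  push_cast at hpqN
  let t := p * a₂ - q * a₁
  refine ⟨⟨!![p + t * c, q + t * d; c, d], ?_⟩, ?_⟩
  · rw [Matrix.det_fin_two_of]
    linear_combination hpq
  · refine Subtype.ext (Subtype.ext (funext fun i => ?_))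
    fin_cases i
    · refine Prod.ext ?_ hc
      change ((p + t * c : ℤ) : ZMod N) = (β.1 0).1
      rw [← ha₁]
      simp only [t]
      push_cast
      linear_combination (a₁ : ZMod N) * hpqN - (p : ZMod N) * hβ
    · refine Prod.ext ?_ hd
      change ((q + t * d : ℤ) : ZMod N) = (β.1 1).1
      rw [← ha₂]
      simp only [t]
      push_cast
      linear_combination (a₂ : ZMod N) * hpqN - (q : ZMod N) * hβ

theorem statement_5 (N M : ℕ) (hN : 2 ≤ N) (hM : 1 ≤ M) :
    ∃ F : Quotient (QuotientGroup.rightRel (GammaNM N M)) →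
        {β : GenTuple 2 (ZMod N × ZMod (M*N)) // detp N M β = 1},
      Function.Bijective F ∧
      ∀ γ : Matrix.SpecialLinearGroup (Fin 2) ℤ,
        (F (Quotient.mk (QuotientGroup.rightRel (GammaNM N M)) γ)).1.1 =
          ![(((γ.1 0 0 : ℤ) : ZMod N), ((γ.1 1 0 : ℤ) : ZMod (M*N))),
            (((γ.1 0 1 : ℤ) : ZMod N), ((γ.1 1 1 : ℤ) : ZMod (M*N)))] := by
  have : NeZero (M*N) := ⟨Nat.mul_ne_zero (by omega) (by omega)⟩
  refine ⟨Quotient.lift (genTupleOfSL N M) ?_, ⟨?_, ?_⟩, fun _ => rfl⟩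
  · intro γ δ h
    exact Subtype.ext (Subtype.ext
      (reducedColumns_eq_iff_mem.2 (QuotientGroup.rightRel_apply.1 h)))
  · rintro ⟨γ⟩ ⟨δ⟩ h
    exact Quotient.sound (QuotientGroup.rightRel_apply.2
      (reducedColumns_eq_iff_mem.1 (congrArg (fun β => β.1.1) h)))
  · intro β
    obtain ⟨γ, rfl⟩ := genTupleOfSL_surjective N M β
    exact ⟨Quotient.mk _ γ, rfl⟩
end

section
/- Let N ≥ 3 and M ≥ 1 be integers and A = ℤ/N × ℤ/MN. Then there is an isomorphism of abelian groups M₂⁻(A) ≅ ⨁_{k ∈ (ℤ/N)ˣ/⟨±1⟩} M_{2,k}⁻, where each M_{2,k}⁻ is identified with the subgroup of M₂⁻(A) spanned by the symbols of determinant ±k; consequently M₂⁻(A) is isomorphic to the direct sum of φ(N)/2 copies of M_{2,1}⁻ (φ = Euler's totient function). -/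
open FreeAbelianGroup AddSubgroup

namespace KPT

variable (n : ℕ) (A : Type) [AddCommGroup A]

/-- Reordering relation (O). -/
def relO : Set (FreeAbelianGroup (GenTuple n A)) :=
  {x | ∃ (β β' : GenTuple n A) (σ : Equiv.Perm (Fin n)),
    β'.1 = β.1 ∘ σ ∧ x = of β - of β'}

/-- Motivic blowup relation (M). -/
def relM : Set (FreeAbelianGroup (GenTuple n A)) :=
  {x | ∃ (hn : 2 ≤ n) (β β₁ β₂ : GenTuple n A),
    β₁.1 = Function.update β.1 ⟨0, by omega⟩
      (β.1 ⟨0, by omega⟩ - β.1 ⟨1, by omega⟩) ∧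
    β₂.1 = Function.update β.1 ⟨1, by omega⟩
      (β.1 ⟨1, by omega⟩ - β.1 ⟨0, by omega⟩) ∧
    x = of β - of β₁ - of β₂}

/-- Anti-symmetry relation (A). -/
def relA : Set (FreeAbelianGroup (GenTuple n A)) :=
  {x | ∃ (hn : 1 ≤ n) (β β' : GenTuple n A),
    β'.1 = Function.update β.1 ⟨0, by omega⟩ (-(β.1 ⟨0, by omega⟩)) ∧
    x = of β + of β'}

/-- The Kontsevich–Pestun–Tschinkel group `M_n(A)`. -/
def Mn : Type :=
  FreeAbelianGroup (GenTuple n A) ⧸ AddSubgroup.closure (relO n A ∪ relM n A)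

instance : AddCommGroup (Mn n A) := QuotientAddGroup.Quotient.addCommGroup _

/-- The group `M_n^-(A)`. -/
def MnMinus : Type :=
  FreeAbelianGroup (GenTuple n A) ⧸
    AddSubgroup.closure (relO n A ∪ relM n A ∪ relA n A)

instance : AddCommGroup (MnMinus n A) := QuotientAddGroup.Quotient.addCommGroup _

/-- The symbol `⟨b₁,…,b_n⟩ ∈ M_n(A)`. -/
def symb (β : GenTuple n A) : Mn n A := QuotientAddGroup.mk (of β)

/-- The symbol `⟨b₁,…,b_n⟩⁻ ∈ M_n⁻(A)`. -/
def symbm (β : GenTuple n A) : MnMinus n A := QuotientAddGroup.mk (of β)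

/-- The natural surjection `M_n(A) → M_n⁻(A)`. -/
def toMinus : Mn n A →+ MnMinus n A :=
  QuotientAddGroup.map _ _ (AddMonoidHom.id _)
    (by
      intro x hx
      simp only [AddSubgroup.mem_comap, AddMonoidHom.id_apply]
      exact AddSubgroup.closure_mono (Set.subset_union_left) hx)

/-- The kernel `K_n(A)` of `M_n(A) → M_n⁻(A)`. -/
def Kn : AddSubgroup (Mn n A) := (toMinus n A).ker

end KPT


open FreeAbelianGroup

namespace KPT2

variable (N M : ℕ)

/-- The set `S_{2,k} ∪ S_{2,-k}`: generating pairs of `ℤ/N × ℤ/MN` with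
determinant `± k`. -/
def Tk (k : (ZMod N)ˣ) : Type :=
  {β : GenTuple 2 (ZMod N × ZMod (M*N)) //
    detp N M β = (k : ZMod N) ∨ detp N M β = -(k : ZMod N)}

/-- The reordering relation (O) on symbols of determinant `±k`. -/
def relOk (k : (ZMod N)ˣ) : Set (FreeAbelianGroup (Tk N M k)) :=
  {x | ∃ β β' : Tk N M k,
    β'.1.1 0 = β.1.1 1 ∧ β'.1.1 1 = β.1.1 0 ∧ x = of β - of β'}

/-- The motivic blowup relation (M) on symbols of determinant `±k`. -/
def relMk (k : (ZMod N)ˣ) : Set (FreeAbelianGroup (Tk N M k)) :=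
  {x | ∃ β β₁ β₂ : Tk N M k,
    β₁.1.1 0 = β.1.1 0 - β.1.1 1 ∧ β₁.1.1 1 = β.1.1 1 ∧
    β₂.1.1 0 = β.1.1 0 ∧ β₂.1.1 1 = β.1.1 1 - β.1.1 0 ∧
    x = of β - of β₁ - of β₂}

/-- The anti-symmetry relation (A) on symbols of determinant `±k`. -/
def relAk (k : (ZMod N)ˣ) : Set (FreeAbelianGroup (Tk N M k)) :=
  {x | ∃ β β' : Tk N M k,
    β'.1.1 0 = -β.1.1 0 ∧ β'.1.1 1 = β.1.1 1 ∧ x = of β + of β'}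

/-- The group `M⁻_{2,k}(ℤ/N × ℤ/MN)`. -/
def M2kMinus (k : (ZMod N)ˣ) : Type :=
  FreeAbelianGroup (Tk N M k) ⧸
    AddSubgroup.closure (relOk N M k ∪ relMk N M k ∪ relAk N M k)

instance (k : (ZMod N)ˣ) : AddCommGroup (M2kMinus N M k) :=
  QuotientAddGroup.Quotient.addCommGroup _

/-- The symbol `⟨(a₁,b₁),(a₂,b₂)⟩⁻ ∈ M⁻_{2,k}`. -/
def symb2k (k : (ZMod N)ˣ) (β : Tk N M k) : M2kMinus N M k :=
  QuotientAddGroup.mk (of β)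

end KPT2

attribute [local instance] Classical.propDecidable

namespace KPT

variable {A G : Type} [AddCommGroup A] [AddCommGroup G]

/-- The homomorphism out of `M₂⁻(A)` induced by a function on symbols respecting the relations. -/
def liftMinus (f : GenTuple 2 A → G)
    (hO : ∀ β β' : GenTuple 2 A, β'.1 0 = β.1 1 → β'.1 1 = β.1 0 → f β = f β')
    (hM : ∀ β β₁ β₂ : GenTuple 2 A, β₁.1 0 = β.1 0 - β.1 1 → β₁.1 1 = β.1 1 →
      β₂.1 0 = β.1 0 → β₂.1 1 = β.1 1 - β.1 0 → f β = f β₁ + f β₂)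
    (hA : ∀ β β' : GenTuple 2 A, β'.1 0 = -β.1 0 → β'.1 1 = β.1 1 → f β = -f β') :
    MnMinus 2 A →+ G :=
  QuotientAddGroup.lift _ (FreeAbelianGroup.lift f) (by
    rw [AddSubgroup.closure_le]
    rintro x ((⟨β, β', σ, h, rfl⟩ | ⟨_, β, β₁, β₂, h₁, h₂, rfl⟩) | ⟨_, β, β', h, rfl⟩)
    · simp only [SetLike.mem_coe, AddMonoidHom.mem_ker, map_sub, lift_apply_of, sub_eq_zero]
      have hσ : σ 0 = 0 ∧ σ 1 = 1 ∨ σ 0 = 1 ∧ σ 1 = 0 := by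
        have := σ.injective.ne (show (0 : Fin 2) ≠ 1 by decide)
        omega
      rcases hσ with ⟨h0, h1⟩ | ⟨h0, h1⟩
      · congr 1
        refine Subtype.ext (funext fun i => ?_)
        fin_cases i <;> simp [h, h0, h1]
      · exact hO β β' (by simp [h, h0]) (by simp [h, h1])
    · simp only [SetLike.mem_coe, AddMonoidHom.mem_ker, map_sub, lift_apply_of]
      rw [hM β β₁ β₂ (by rw [h₁]; simp) (by rw [h₁]; simp) (by rw [h₂]; simp)
        (by rw [h₂]; simp)]
      abel
    · simp only [SetLike.mem_coe, AddMonoidHom.mem_ker, map_add, lift_apply_of]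
      rw [hA β β' (by rw [h]; simp) (by rw [h]; simp), neg_add_cancel])

theorem liftMinus_symbm (f : GenTuple 2 A → G) (hO) (hM) (hA) (β : GenTuple 2 A) :
    liftMinus f hO hM hA (symbm 2 A β) = f β :=
  lift_apply_of f β

theorem MnMinus.hom_ext {n : ℕ} {f g : MnMinus n A →+ G}
    (h : ∀ β, f (symbm n A β) = g (symbm n A β)) : f = g :=
  QuotientAddGroup.addMonoidHom_ext _ (FreeAbelianGroup.lift_ext _ _ h)

theorem symbm_swap {β β' : GenTuple 2 A} (h0 : β'.1 0 = β.1 1) (h1 : β'.1 1 = β.1 0) :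
    symbm 2 A β = symbm 2 A β' := by
  rw [← sub_eq_zero]
  refine (QuotientAddGroup.eq_zero_iff (of β - of β')).2
    (subset_closure (.inl (.inl ⟨β, β', Equiv.swap 0 1, funext fun i => ?_, rfl⟩)))
  fin_cases i <;> simp [h0, h1]

theorem symbm_blowup {β β₁ β₂ : GenTuple 2 A} (h₁0 : β₁.1 0 = β.1 0 - β.1 1)
    (h₁1 : β₁.1 1 = β.1 1) (h₂0 : β₂.1 0 = β.1 0) (h₂1 : β₂.1 1 = β.1 1 - β.1 0) :
    symbm 2 A β = symbm 2 A β₁ + symbm 2 A β₂ := by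
  rw [← sub_eq_zero, ← sub_sub]
  refine (QuotientAddGroup.eq_zero_iff (of β - of β₁ - of β₂)).2
    (subset_closure (.inl (.inr ⟨le_rfl, β, β₁, β₂, funext fun i => ?_, funext fun i => ?_, rfl⟩)))
  · fin_cases i <;> simp [h₁0, h₁1]
  · fin_cases i <;> simp [h₂0, h₂1]

theorem symbm_neg {β β' : GenTuple 2 A} (h0 : β'.1 0 = -β.1 0) (h1 : β'.1 1 = β.1 1) :
    symbm 2 A β = -symbm 2 A β' := by
  rw [eq_neg_iff_add_eq_zero]
  refine (QuotientAddGroup.eq_zero_iff (of β + of β')).2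
    (subset_closure (.inr ⟨one_le_two, β, β', funext fun i => ?_, rfl⟩))
  fin_cases i <;> simp [h0, h1]

end KPT

/-- The action of an automorphism on generating tuples. -/
def GenTuple.map {n : ℕ} {A : Type} [AddCommGroup A] (φ : A ≃+ A) (β : GenTuple n A) :
    GenTuple n A :=
  ⟨φ ∘ β.1, by
    have h := AddMonoidHom.map_closure (φ : A →+ A) (Set.range β.1)
    rw [β.2, ← AddMonoidHom.range_eq_map,
      AddMonoidHom.range_eq_top_of_surjective _ φ.surjective] at h
    rw [Set.range_comp]
    exact h.symm⟩

theorem isUnit_detp (N M : ℕ) (β : GenTuple 2 (ZMod N × ZMod (M*N))) : IsUnit (detp N M β) := by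
  have hr : Set.range β.1 = {β.1 0, β.1 1} := by
    ext x
    simp [eq_comm]
  have hβ := β.2
  rw [hr] at hβ
  obtain ⟨m, n, h⟩ := AddSubgroup.mem_closure_pair.1
    (hβ ▸ AddSubgroup.mem_top ((1, 0) : ZMod N × ZMod (M*N)))
  obtain ⟨p, q, h'⟩ := AddSubgroup.mem_closure_pair.1
    (hβ ▸ AddSubgroup.mem_top ((0, 1) : ZMod N × ZMod (M*N)))
  have h1 := congrArg Prod.fst h
  have h2 := congrArg (ZMod.castHom (dvd_mul_left N M) (ZMod N)) (congrArg Prod.snd h)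
  have h1' := congrArg Prod.fst h'
  have h2' := congrArg (ZMod.castHom (dvd_mul_left N M) (ZMod N)) (congrArg Prod.snd h')
  simp only [Prod.fst_add, Prod.snd_add, Prod.smul_fst, Prod.smul_snd, map_add, map_zsmul,
    map_zero, map_one] at h1 h2 h1' h2'
  simp only [zsmul_eq_mul] at h1 h2 h1' h2'
  refine IsUnit.of_mul_eq_one ((m * q - n * p : ℤ) : ZMod N) ?_
  rw [detp]
  generalize ZMod.castHom (dvd_mul_left N M) (ZMod N) (β.1 0).2 = b₀ at *
  generalize ZMod.castHom (dvd_mul_left N M) (ZMod N) (β.1 1).2 = b₁ at *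
  push_cast
  linear_combination (p * b₀ + q * b₁ : ZMod N) * h1 + h2'
    - (p * (β.1 0).1 + q * (β.1 1).1 : ZMod N) * h2

namespace KPT2

variable {N M : ℕ}

section Detp

variable {β β' : GenTuple 2 (ZMod N × ZMod (M*N))}

theorem detp_swap (h0 : β'.1 0 = β.1 1) (h1 : β'.1 1 = β.1 0) :
    detp N M β' = -detp N M β := by
  simp only [detp, h0, h1]
  ring

theorem detp_sub_left (h0 : β'.1 0 = β.1 0 - β.1 1) (h1 : β'.1 1 = β.1 1) :
    detp N M β' = detp N M β := by
  simp only [detp, h0, h1, Prod.fst_sub, Prod.snd_sub, map_sub]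
  ring

theorem detp_sub_right (h0 : β'.1 0 = β.1 0) (h1 : β'.1 1 = β.1 1 - β.1 0) :
    detp N M β' = detp N M β := by
  simp only [detp, h0, h1, Prod.fst_sub, Prod.snd_sub, map_sub]
  ring

theorem detp_neg_left (h0 : β'.1 0 = -β.1 0) (h1 : β'.1 1 = β.1 1) :
    detp N M β' = -detp N M β := by
  simp only [detp, h0, h1, Prod.fst_neg, Prod.snd_neg, map_neg]
  ring

end Detp

section Lift

variable {G : Type} [AddCommGroup G] {k : (ZMod N)ˣ}

/-- The homomorphism out of `M⁻_{2,k}` induced by a function on symbols respecting the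
relations. -/
def liftM2k (f : Tk N M k → G)
    (hO : ∀ β β' : Tk N M k, β'.1.1 0 = β.1.1 1 → β'.1.1 1 = β.1.1 0 → f β = f β')
    (hM : ∀ β β₁ β₂ : Tk N M k, β₁.1.1 0 = β.1.1 0 - β.1.1 1 → β₁.1.1 1 = β.1.1 1 →
      β₂.1.1 0 = β.1.1 0 → β₂.1.1 1 = β.1.1 1 - β.1.1 0 → f β = f β₁ + f β₂)
    (hA : ∀ β β' : Tk N M k, β'.1.1 0 = -β.1.1 0 → β'.1.1 1 = β.1.1 1 → f β = -f β') :
    M2kMinus N M k →+ G :=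
  QuotientAddGroup.lift _ (FreeAbelianGroup.lift f) (by
    rw [AddSubgroup.closure_le]
    rintro x ((⟨β, β', h0, h1, rfl⟩ | ⟨β, β₁, β₂, h₁0, h₁1, h₂0, h₂1, rfl⟩) | ⟨β, β', h0, h1, rfl⟩)
    · simp [hO β β' h0 h1]
    · simp [hM β β₁ β₂ h₁0 h₁1 h₂0 h₂1]
    · simp [hA β β' h0 h1])

theorem liftM2k_symb2k (f : Tk N M k → G) (hO) (hM) (hA) (β : Tk N M k) :
    liftM2k f hO hM hA (symb2k N M k β) = f β :=
  lift_apply_of f β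

theorem M2kMinus.hom_ext {f g : M2kMinus N M k →+ G}
    (h : ∀ β, f (symb2k N M k β) = g (symb2k N M k β)) : f = g :=
  QuotientAddGroup.addMonoidHom_ext _ (FreeAbelianGroup.lift_ext _ _ h)

end Lift

section Symb

variable {k : (ZMod N)ˣ}

theorem symb2k_swap {β β' : Tk N M k} (h0 : β'.1.1 0 = β.1.1 1) (h1 : β'.1.1 1 = β.1.1 0) :
    symb2k N M k β = symb2k N M k β' := by
  rw [← sub_eq_zero]
  exact (QuotientAddGroup.eq_zero_iff (of β - of β')).2
    (subset_closure (.inl (.inl ⟨β, β', h0, h1, rfl⟩)))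

theorem symb2k_blowup {β β₁ β₂ : Tk N M k} (h₁0 : β₁.1.1 0 = β.1.1 0 - β.1.1 1)
    (h₁1 : β₁.1.1 1 = β.1.1 1) (h₂0 : β₂.1.1 0 = β.1.1 0) (h₂1 : β₂.1.1 1 = β.1.1 1 - β.1.1 0) :
    symb2k N M k β = symb2k N M k β₁ + symb2k N M k β₂ := by
  rw [← sub_eq_zero, ← sub_sub]
  exact (QuotientAddGroup.eq_zero_iff (of β - of β₁ - of β₂)).2
    (subset_closure (.inl (.inr ⟨β, β₁, β₂, h₁0, h₁1, h₂0, h₂1, rfl⟩)))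

theorem symb2k_neg {β β' : Tk N M k} (h0 : β'.1.1 0 = -β.1.1 0) (h1 : β'.1.1 1 = β.1.1 1) :
    symb2k N M k β = -symb2k N M k β' := by
  rw [eq_neg_iff_add_eq_zero]
  exact (QuotientAddGroup.eq_zero_iff (of β + of β')).2
    (subset_closure (.inr ⟨β, β', h0, h1, rfl⟩))

end Symb

/-- Multiplication of the first coordinate of `ℤ/N × ℤ/MN` by a unit. -/
def scale (M : ℕ) (u : (ZMod N)ˣ) : (ZMod N × ZMod (M*N)) ≃+ (ZMod N × ZMod (M*N)) :=
  (DistribMulAction.toAddEquiv (ZMod N) u).prodCongr (AddEquiv.refl _)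

theorem scale_apply (u : (ZMod N)ˣ) (x : ZMod N × ZMod (M*N)) :
    scale M u x = (u * x.1, x.2) := rfl

theorem detp_map_scale (u : (ZMod N)ˣ) (β : GenTuple 2 (ZMod N × ZMod (M*N))) :
    detp N M (β.map (scale M u)) = u * detp N M β := by
  simp only [detp, GenTuple.map, Function.comp_apply, scale_apply]
  ring

/-- Scaling by `u` takes symbols of determinant `±k` to symbols of determinant `±uk`. -/
def Tk.scale {k l : (ZMod N)ˣ} (u : (ZMod N)ˣ) (h : l = u * k) (β : Tk N M k) : Tk N M l :=
  ⟨β.1.map (KPT2.scale M u), by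
    rw [detp_map_scale, h]
    rcases β.2 with hβ | hβ <;> simp [hβ]⟩

/-- The homomorphism `M⁻_{2,k} → M⁻_{2,uk}` induced by scaling. -/
def scaleHom (M : ℕ) {k l : (ZMod N)ˣ} (u : (ZMod N)ˣ) (h : l = u * k) :
    M2kMinus N M k →+ M2kMinus N M l :=
  liftM2k (fun β => symb2k N M l (β.scale u h))
    (fun β β' h0 h1 => symb2k_swap (by simp [Tk.scale, GenTuple.map, h0])
      (by simp [Tk.scale, GenTuple.map, h1]))
    (fun β β₁ β₂ h₁0 h₁1 h₂0 h₂1 => symb2k_blowup (by simp [Tk.scale, GenTuple.map, h₁0])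
      (by simp [Tk.scale, GenTuple.map, h₁1]) (by simp [Tk.scale, GenTuple.map, h₂0])
      (by simp [Tk.scale, GenTuple.map, h₂1]))
    (fun β β' h0 h1 => symb2k_neg (by simp [Tk.scale, GenTuple.map, h0])
      (by simp [Tk.scale, GenTuple.map, h1]))

theorem scaleHom_comp {k l : (ZMod N)ˣ} (u v : (ZMod N)ˣ) (h : l = u * k) (h' : k = v * l)
    (huv : v * u = 1) : (scaleHom M v h').comp (scaleHom M u h) = AddMonoidHom.id _ := by
  refine M2kMinus.hom_ext fun β => ?_
  simp only [scaleHom, AddMonoidHom.comp_apply, liftM2k_symb2k, AddMonoidHom.id_apply]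
  congr 1
  refine Subtype.ext (Subtype.ext (funext fun i => ?_))
  have huv' : (v * u : ZMod N) = 1 := by rw [← Units.val_mul, huv, Units.val_one]
  simp [Tk.scale, GenTuple.map, scale_apply, ← mul_assoc, huv']

/-- All the groups `M⁻_{2,k}` are isomorphic to `M⁻_{2,1}`. -/
def scaleEquiv (M : ℕ) (k : (ZMod N)ˣ) : M2kMinus N M k ≃+ M2kMinus N M 1 :=
  (scaleHom M k⁻¹ (by simp)).toAddEquiv (scaleHom M k (by simp))
    (scaleHom_comp _ _ _ _ (by simp)) (scaleHom_comp _ _ _ _ (by simp))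

/-- The inclusion of symbols of determinant `±k` induces `M⁻_{2,k} → M₂⁻`. -/
def incl (M : ℕ) (k : (ZMod N)ˣ) : M2kMinus N M k →+ KPT.MnMinus 2 (ZMod N × ZMod (M*N)) :=
  liftM2k (fun β => KPT.symbm 2 _ β.1) (fun _ _ => KPT.symbm_swap)
    (fun _ _ _ => KPT.symbm_blowup) (fun _ _ => KPT.symbm_neg)

theorem incl_symb2k (k : (ZMod N)ˣ) (β : Tk N M k) :
    incl M k (symb2k N M k β) = KPT.symbm 2 _ β.1 :=
  liftM2k_symb2k _ _ _ _ β

theorem mk_eq_mk_iff (k l : (ZMod N)ˣ) :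
    (k : (ZMod N)ˣ ⧸ Subgroup.zpowers (-1 : (ZMod N)ˣ)) = l ↔
      (k : ZMod N) = l ∨ (k : ZMod N) = -l := by
  have hz : ∀ x : (ZMod N)ˣ, x ∈ Subgroup.zpowers (-1 : (ZMod N)ˣ) ↔ x = 1 ∨ x = -1 := by
    intro x
    constructor
    · rintro ⟨n, rfl⟩
      exact n.even_or_odd.imp (fun h => h.neg_one_zpow) (fun h => h.neg_one_zpow)
    · rintro (rfl | rfl)
      exacts [one_mem _, Subgroup.mem_zpowers _]
  rw [QuotientGroup.eq, hz, ← Units.val_neg, Units.val_inj, Units.val_inj, inv_mul_eq_iff_eq_mul,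
    inv_mul_eq_iff_eq_mul, mul_one, mul_neg_one, eq_comm (a := l), eq_comm (a := l),
    neg_eq_iff_eq_neg]

/-- The class of the determinant of a symbol in `(ℤ/N)ˣ/⟨±1⟩`. -/
noncomputable def detClass (β : GenTuple 2 (ZMod N × ZMod (M*N))) :
    (ZMod N)ˣ ⧸ Subgroup.zpowers (-1 : (ZMod N)ˣ) :=
  QuotientGroup.mk (isUnit_detp N M β).unit

theorem detClass_eq_iff {β : GenTuple 2 (ZMod N × ZMod (M*N))}
    {q : (ZMod N)ˣ ⧸ Subgroup.zpowers (-1 : (ZMod N)ˣ)} :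
    detClass β = q ↔ detp N M β = (q.out : ZMod N) ∨ detp N M β = -(q.out : ZMod N) := by
  conv_lhs => rw [← QuotientGroup.out_eq' q]
  exact mk_eq_mk_iff _ _

variable (N M) in
/-- The direct sum of the groups `M⁻_{2,k}` over `k ∈ (ℤ/N)ˣ/⟨±1⟩`. -/
abbrev SumM2k : Type :=
  DirectSum ((ZMod N)ˣ ⧸ Subgroup.zpowers (-1 : (ZMod N)ˣ)) (fun q => M2kMinus N M q.out)

/-- The image of a symbol in the summand singled out by its determinant. -/
noncomputable def toSum (β : GenTuple 2 (ZMod N × ZMod (M*N))) : SumM2k N M :=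
  DirectSum.of (fun q => M2kMinus N M q.out) (detClass β)
    (symb2k N M _ ⟨β, detClass_eq_iff.1 rfl⟩)

theorem toSum_eq (β : GenTuple 2 (ZMod N × ZMod (M*N)))
    (q : (ZMod N)ˣ ⧸ Subgroup.zpowers (-1 : (ZMod N)ˣ))
    (h : detp N M β = (q.out : ZMod N) ∨ detp N M β = -(q.out : ZMod N)) :
    toSum β = DirectSum.of (fun q => M2kMinus N M q.out) q (symb2k N M q.out ⟨β, h⟩) := by
  obtain rfl := detClass_eq_iff.2 h
  rfl

/-- The homomorphism `M₂⁻ → ⨁ M⁻_{2,k}` sorting symbols by determinant. -/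
noncomputable def sumHom (N M : ℕ) : KPT.MnMinus 2 (ZMod N × ZMod (M*N)) →+ SumM2k N M :=
  KPT.liftMinus toSum
    (fun β β' h0 h1 => by
      have h := detClass_eq_iff.1 (rfl : detClass β = detClass β)
      have h' := h
      rw [← neg_neg (detp N M β), ← detp_swap h0 h1, neg_inj, neg_eq_iff_eq_neg, or_comm] at h'
      exact (toSum_eq β _ h).trans
        ((congrArg _ (symb2k_swap h0 h1)).trans (toSum_eq β' _ h').symm))
    (fun β β₁ β₂ h₁0 h₁1 h₂0 h₂1 => by
      have h := detClass_eq_iff.1 (rfl : detClass β = detClass β)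
      have h₁ := h
      have h₂ := h
      rw [← detp_sub_left h₁0 h₁1] at h₁
      rw [← detp_sub_right h₂0 h₂1] at h₂
      rw [toSum_eq β _ h, toSum_eq β₁ _ h₁, toSum_eq β₂ _ h₂, ← map_add]
      exact congrArg _ (symb2k_blowup h₁0 h₁1 h₂0 h₂1))
    (fun β β' h0 h1 => by
      have h := detClass_eq_iff.1 (rfl : detClass β = detClass β)
      have h' := h
      rw [← neg_neg (detp N M β), ← detp_neg_left h0 h1, neg_inj, neg_eq_iff_eq_neg, or_comm] at h'
      rw [toSum_eq β _ h, toSum_eq β' _ h', ← map_neg]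
      exact congrArg _ (symb2k_neg h0 h1))

theorem sumHom_symbm (β : GenTuple 2 (ZMod N × ZMod (M*N))) :
    sumHom N M (KPT.symbm 2 _ β) = toSum β :=
  KPT.liftMinus_symbm _ _ _ _ β

/-- The isomorphism `M₂⁻ ≃ ⨁ M⁻_{2,k}`. -/
noncomputable def sumEquiv (N M : ℕ) :
    KPT.MnMinus 2 (ZMod N × ZMod (M*N)) ≃+ SumM2k N M :=
  (sumHom N M).toAddEquiv (DirectSum.toAddMonoid fun q => incl M q.out)
    (KPT.MnMinus.hom_ext fun β => by
      rw [AddMonoidHom.comp_apply, sumHom_symbm, toSum, DirectSum.toAddMonoid_of]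
      exact incl_symb2k _ _)
    (DirectSum.addHom_ext' fun q => M2kMinus.hom_ext fun β => by
      rw [AddMonoidHom.comp_apply, AddMonoidHom.comp_apply, DirectSum.toAddMonoid_of, incl_symb2k,
        sumHom_symbm]
      exact toSum_eq β.1 q β.2)

theorem card_units_quotient (hN : 3 ≤ N) :
    Nat.card ((ZMod N)ˣ ⧸ Subgroup.zpowers (-1 : (ZMod N)ˣ)) = N.totient / 2 := by
  have : NeZero N := ⟨by omega⟩
  have : Fact (1 < N) := ⟨by omega⟩
  have ho : orderOf (-1 : (ZMod N)ˣ) = 2 := by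
    rw [← orderOf_units, Units.val_neg, Units.val_one, orderOf_neg_one,
      if_neg (by rw [ZMod.ringChar_zmod_n]; omega)]
  have h := Subgroup.card_eq_card_quotient_mul_card_subgroup (Subgroup.zpowers (-1 : (ZMod N)ˣ))
  rw [Nat.card_zpowers, ho, Nat.card_eq_fintype_card, ZMod.card_units_eq_totient] at h
  omega

end KPT2

open KPT KPT2 in
theorem statement_7 (N M : ℕ) (hN : 3 ≤ N) (hM : 1 ≤ M) :
    ∃ e : MnMinus 2 (ZMod N × ZMod (M*N)) ≃+
        DirectSum ((ZMod N)ˣ ⧸ Subgroup.zpowers (-1 : (ZMod N)ˣ))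
          (fun q => M2kMinus N M q.out),
      -- `e` identifies each `M⁻_{2,k}` with the subgroup of `M₂⁻` spanned by the
      -- symbols of determinant `±k`
      (∀ (q : (ZMod N)ˣ ⧸ Subgroup.zpowers (-1 : (ZMod N)ˣ))
        (β : GenTuple 2 (ZMod N × ZMod (M*N)))
        (h : detp N M β = (q.out : ZMod N) ∨ detp N M β = -(q.out : ZMod N)),
        e (symbm 2 (ZMod N × ZMod (M*N)) β)
          = DirectSum.of (fun q => M2kMinus N M q.out) q (symb2k N M q.out ⟨β, h⟩)) ∧
      -- consequently `M₂⁻` is a direct sum of `φ(N)/2` copies of `M⁻_{2,1}`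
      Nonempty (MnMinus 2 (ZMod N × ZMod (M*N)) ≃+
        DirectSum (Fin (N.totient / 2)) (fun _ => M2kMinus N M 1)) := by
  have : NeZero N := ⟨by omega⟩
  refine ⟨sumEquiv N M, fun q β h => ?_, ⟨?_⟩⟩
  · exact (sumHom_symbm β).trans (toSum_eq β q h)
  · refine (sumEquiv N M).trans ?_
    exact (DFinsupp.mapRange.addEquiv fun q => scaleEquiv M q.out).trans
      (DirectSum.equivCongrLeft (Finite.equivFinOfCardEq (card_units_quotient hN)))
end
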